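/- Let L ⊆ 2^ω be a Luzin set with no isolated points (in its subspace topology), let f : L → 2^ω be an injective continuous map, and let X ⊆ 2^ω be such that f[L] ∩ X is uncountable. Then there exist a nonempty Polish space R and a continuous nowhere constant map g : R → 2^ω such that g⁻¹[X] is not meager in R; consequently X is not universally meager. -/

import Mathlib

/-- A set `X ⊆ 2^ω` is *universally meager* if for every injective Borel-measurable
map `f : 2^ω → 2^ω` the image `f '' X` is meager in `2^ω`. -/
def UniversallyMeager (X : Set (ℕ → Bool)) : Prop :=
  ∀ f : (ℕ → Bool) → (ℕ → Bool), Function.Injective f → Measurable f →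
    IsMeagre (f '' X)

section

open Set Topology Filter

namespace Filter.EventuallyEq

variable {α : Type*} [TopologicalSpace α] {s t : Set α}

theorem isMeagre_diff (h : s =ᵇ t) : IsMeagre (s \ t) := by
  rw [IsMeagre]
  filter_upwards [h.mem_iff] with x hx
  simp only [mem_compl_iff, Set.mem_sdiff, hx]
  tauto

end Filter.EventuallyEq

/-- A Gδ subset of a Polish space is Polish. -/
theorem IsGδ.polishSpace {α : Type*} [TopologicalSpace α] [PolishSpace α] {s : Set α}
    (hs : IsGδ s) : PolishSpace s := by
  obtain ⟨u, hu, rfl⟩ := hs.eq_iInter_nat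
  have (n : ℕ) : PolishSpace (u n) := (hu n).polishSpace
  let φ : (⋂ n, u n : Set α) → ∀ n, u n := fun x n ↦ ⟨x, mem_iInter.1 x.2 n⟩
  have hφ : Continuous φ := by fun_prop
  have hind : IsInducing φ :=
    .of_comp hφ (g := fun y ↦ (y 0 : α)) (by fun_prop) IsInducing.subtypeVal
  have hinj : Function.Injective φ := fun x y h ↦
    Subtype.ext (congrArg (fun z ↦ (z 0 : α)) h)
  have hrange : range φ = ⋂ n, {y | (y n : α) = y 0} := by
    ext y
    simp only [mem_range, mem_iInter, mem_ofPred_eq]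
    constructor
    · rintro ⟨x, rfl⟩ n
      rfl
    · intro h
      exact ⟨⟨y 0, mem_iInter.2 fun n ↦ h n ▸ (y n).2⟩, funext fun n ↦ Subtype.ext (h n).symm⟩
  have hclosed : IsClosed (range φ) := by
    rw [hrange]
    exact isClosed_iInter fun n ↦ isClosed_eq (by fun_prop) (by fun_prop)
  exact IsClosedEmbedding.polishSpace ⟨⟨hind, hinj⟩, hclosed⟩

section CategoryIdeal

variable {R Y : Type*} [TopologicalSpace R] [SecondCountableTopology R] [MeasurableSpace R]
  [BorelSpace R] [MeasurableSpace Y] {g : R → Y}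

/-- Every set `U` has a measurable envelope with respect to `g`: a smallest measurable set, modulo
sets with meager preimage, whose preimage contains `U` modulo a meager set. -/
theorem exists_measurableSet_isMeagre_diff_envelope (hg : Measurable g) (U : Set R) :
    ∃ B, MeasurableSet B ∧ IsMeagre (U \ g ⁻¹' B) ∧
      ∀ D, MeasurableSet D → IsMeagre (U \ g ⁻¹' D) → IsMeagre (g ⁻¹' (B \ D)) := by
  let ι := {D : Set Y // MeasurableSet D ∧ IsMeagre (g ⁻¹' D ∩ U)}
  have hV (D : ι) : ∃ V : Set R, IsOpen V ∧ g ⁻¹' D.1 =ᵇ V := (hg D.2.1).residualEq_isOpen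
  choose V hVo hV using hV
  obtain ⟨T, hTc, hT⟩ := TopologicalSpace.isOpen_iUnion_countable V hVo
  refine ⟨(⋃ D ∈ T, D.1)ᶜ, (MeasurableSet.biUnion hTc fun D _ ↦ D.2.1).compl, ?_, ?_⟩
  · refine (isMeagre_biUnion hTc fun D _ ↦ D.2.2).mono ?_
    intro x hx
    simp only [preimage_compl, Set.mem_sdiff, mem_compl_iff, not_not, mem_preimage, mem_iUnion] at hx
    obtain ⟨hxU, D, hD, hxD⟩ := hx
    exact mem_biUnion hD ⟨hxD, hxU⟩
  · intro D hD hUD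
    let D' : ι := ⟨Dᶜ, hD.compl, by
    refine hUD.mono fun x hx ↦ ?_
    exact ⟨hx.2, hx.1⟩⟩
    refine ((hV D').isMeagre_diff.union
      (isMeagre_biUnion hTc fun D _ ↦ (hV D).symm.isMeagre_diff)).mono ?_
    rintro x ⟨hxB, hxD⟩
    by_cases hx : x ∈ V D'
    · have : x ∈ ⋃ D ∈ T, V D := hT ▸ mem_iUnion_of_mem D' hx
      simp only [mem_iUnion] at this
      obtain ⟨E, hE, hxE⟩ := this
      refine Or.inr (mem_biUnion hE ⟨hxE, fun h ↦ hxB (mem_biUnion hE h)⟩)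
    · exact Or.inl ⟨hxD, hx⟩

/-- The measurable sets with nonmeager preimage under `g` have a countable dense family. -/
theorem exists_countable_dense_measurableSet [BaireSpace R] (hg : Measurable g) :
    ∃ 𝓑 : Set (Set Y), 𝓑.Countable ∧ (∀ B ∈ 𝓑, MeasurableSet B) ∧
      ∀ D, MeasurableSet D → ¬ IsMeagre (g ⁻¹' D) →
        ∃ B ∈ 𝓑, ¬ IsMeagre (g ⁻¹' B) ∧ IsMeagre (g ⁻¹' (B \ D)) := by
  choose B hBm hB hBmin using exists_measurableSet_isMeagre_diff_envelope hg
  refine ⟨B '' TopologicalSpace.countableBasis R,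
    (TopologicalSpace.countable_countableBasis R).image _, forall_mem_image.2 fun U _ ↦ hBm U, ?_⟩
  intro D hD hDpos
  obtain ⟨V, hVo, hV⟩ := (hg hD).residualEq_isOpen
  obtain ⟨x, hx⟩ : V.Nonempty := by
    by_contra! h
    exact hDpos (by simpa [h] using hV.isMeagre_diff)
  obtain ⟨U, hU, hxU, hUV⟩ :=
    (TopologicalSpace.isBasis_countableBasis R).exists_subset_of_mem_open hx hVo
  refine ⟨B U, mem_image_of_mem B hU, fun h ↦ ?_, hBmin U D hD
    (hV.symm.isMeagre_diff.mono (sdiff_subset_sdiff_left hUV))⟩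
  refine not_isMeagre_of_isOpen (TopologicalSpace.isOpen_of_mem_countableBasis hU) ⟨x, hxU⟩ ?_
  refine ((hB U).union h).mono fun y hy ↦ ?_
  by_cases hyB : y ∈ g ⁻¹' B U
  exacts [Or.inr hyB, Or.inl ⟨hy, hyB⟩]

end CategoryIdeal

section Splitting

variable {R : Type*} [TopologicalSpace R] {g : R → ℕ → Bool}

/-- A set with nonmeager preimage under a map with meager fibers splits into two such sets. -/
theorem exists_split_not_isMeagre_preimage (hfib : ∀ y, IsMeagre (g ⁻¹' {y}))
    {C : Set (ℕ → Bool)} (hC : ¬ IsMeagre (g ⁻¹' C)) :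
    ∃ T, MeasurableSet T ∧ ¬ IsMeagre (g ⁻¹' (C ∩ T)) ∧ ¬ IsMeagre (g ⁻¹' (C \ T)) := by
  by_contra! h
  have key (k : ℕ) : ∃ b : Bool, IsMeagre (g ⁻¹' (C ∩ {x | x k ≠ b})) := by
    by_cases hk : IsMeagre (g ⁻¹' (C ∩ {x | x k = true}))
    · exact ⟨false, by simpa using hk⟩
    · refine ⟨true, h _ ?_ hk⟩
      exact measurableSet_eq_fun (by fun_prop) (by fun_prop)
  choose b hb using key
  refine hC (((isMeagre_iUnion hb).union (hfib b)).mono fun x hx ↦ ?_)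
  by_cases hxb : g x = b
  · exact Or.inr hxb
  · obtain ⟨k, hk⟩ := Function.ne_iff.1 hxb
    exact Or.inl (mem_iUnion.2 ⟨k, hx, hk⟩)

/-- A set with nonmeager preimage splits into two such sets, each of which is decided by a given
measurable set `E` modulo a set with meager preimage. -/
theorem exists_split_deciding (hfib : ∀ y, IsMeagre (g ⁻¹' {y})) {E : Set (ℕ → Bool)}
    (hE : MeasurableSet E) (C : Set (ℕ → Bool)) :
    ∃ T, MeasurableSet T ∧ (¬ IsMeagre (g ⁻¹' C) →
      ¬ IsMeagre (g ⁻¹' (C ∩ T)) ∧ ¬ IsMeagre (g ⁻¹' (C \ T)) ∧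
      (IsMeagre (g ⁻¹' (C ∩ T ∩ E)) ∨ IsMeagre (g ⁻¹' ((C ∩ T) \ E))) ∧
      (IsMeagre (g ⁻¹' (C \ T ∩ E)) ∨ IsMeagre (g ⁻¹' ((C \ T) \ E)))) := by
  by_cases hC : IsMeagre (g ⁻¹' C)
  · exact ⟨∅, .empty, fun h ↦ (h hC).elim⟩
  by_cases h : IsMeagre (g ⁻¹' (C ∩ E)) ∨ IsMeagre (g ⁻¹' (C \ E))
  · obtain ⟨T, hT, h1, h2⟩ := exists_split_not_isMeagre_preimage hfib hC
    refine ⟨T, hT, fun _ ↦ ⟨h1, h2, ?_, ?_⟩⟩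
    · exact h.imp (.mono (preimage_mono (inter_subset_inter_left _ inter_subset_left)))
        (.mono (preimage_mono (sdiff_subset_sdiff_left inter_subset_left)))
    · exact h.imp (.mono (preimage_mono (inter_subset_inter_left _ sdiff_subset)))
        (.mono (preimage_mono (sdiff_subset_sdiff_left sdiff_subset)))
  · push Not at h
    refine ⟨E, hE, fun _ ↦ ⟨h.1, h.2, Or.inr ?_, Or.inl ?_⟩⟩
    · convert IsMeagre.empty (X := R)
      ext x
      simp
    · convert IsMeagre.empty (X := R)
      ext x
      simp

end Splitting

section SplittingTree

variable {α : Type*} (T : ℕ → Set α → Set α)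

/-- The cells of the binary tree of sets obtained by splitting each cell `C` of level `n` along
`T n C`. Finite sequences are listed backwards, as in `PiNat.res`. -/
def splittingCell : List Bool → Set α
  | [] => univ
  | true :: s => splittingCell s ∩ T s.length (splittingCell s)
  | false :: s => splittingCell s \ T s.length (splittingCell s)

open Classical in
/-- The finite branch of length `n` through `splittingCell T` determined by a point. -/
noncomputable def splittingPath (x : α) : ℕ → List Bool
  | 0 => []
  | n + 1 => decide (x ∈ T n (splittingCell T (splittingPath x n))) :: splittingPath x n

open Classical in
/-- The branch through `splittingCell T` determined by a point. -/
noncomputable def splittingMap (x : α) (n : ℕ) : Bool :=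
  decide (x ∈ T n (splittingCell T (splittingPath T x n)))

theorem res_splittingMap (x : α) (n : ℕ) :
    PiNat.res (splittingMap T x) n = splittingPath T x n := by
  induction n with
  | zero => rfl
  | succ n ih => rw [PiNat.res_succ, ih, splittingPath, splittingMap]

theorem mem_splittingCell_iff (x : α) (s : List Bool) :
    x ∈ splittingCell T s ↔ PiNat.res (splittingMap T x) s.length = s := by
  induction s with
  | nil => simp [splittingCell]
  | cons b s ih =>
    cases b <;>
    · simp only [splittingCell, mem_inter_iff, Set.mem_sdiff, ih, List.length_cons, PiNat.res_succ,
        List.cons.injEq]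
      rw [and_comm]
      refine and_congr_left fun h ↦ ?_
      rw [splittingMap, ← res_splittingMap, h]
      simp

theorem mem_splittingCell_res (x : α) (n : ℕ) :
    x ∈ splittingCell T (PiNat.res (splittingMap T x) n) := by
  simp [mem_splittingCell_iff, PiNat.res_length]

variable {T} [MeasurableSpace α]

theorem measurableSet_splittingCell (hT : ∀ n C, MeasurableSet (T n C)) (s : List Bool) :
    MeasurableSet (splittingCell T s) := by
  induction s with
  | nil => exact .univ
  | cons b s ih =>
    cases b
    exacts [ih.diff (hT _ _), ih.inter (hT _ _)]

theorem measurable_splittingMap (hT : ∀ n C, MeasurableSet (T n C)) :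
    Measurable (splittingMap T) := by
  refine measurable_pi_lambda _ fun n ↦ measurable_to_bool ?_
  have : (fun x ↦ splittingMap T x n) ⁻¹' {true} =
      ⋃ s : {s : List Bool // s.length = n}, splittingCell T s ∩ T n (splittingCell T s) := by
    ext x
    simp only [mem_preimage, mem_singleton_iff, mem_iUnion, mem_inter_iff, Subtype.exists,
      exists_prop]
    constructor
    · intro h
      refine ⟨_, PiNat.res_length _ n, mem_splittingCell_res T x n, ?_⟩
      simpa [splittingMap, res_splittingMap] using h
    · rintro ⟨s, rfl, hs, hxT⟩
      rw [mem_splittingCell_iff, res_splittingMap] at hs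
      simpa [splittingMap, hs] using hxT
  rw [this]
  exact .iUnion fun s ↦ (measurableSet_splittingCell hT s).inter (hT _ _)

end SplittingTree

/-- If `g` has meager fibers then, modulo a set with meager preimage under `g`, the space `2^ω`
admits a measurable injection `h` into itself such that `h ∘ g` pulls back meager sets to meager
sets. -/
theorem exists_measurable_injOn_isMeagre_preimage {R : Type*} [TopologicalSpace R]
    [SecondCountableTopology R] [BaireSpace R] [Nonempty R] [MeasurableSpace R] [BorelSpace R]
    {g : R → ℕ → Bool} (hg : Measurable g) (hfib : ∀ y, IsMeagre (g ⁻¹' {y})) :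
    ∃ (h : (ℕ → Bool) → ℕ → Bool) (E : Set (ℕ → Bool)), Measurable h ∧ MeasurableSet E ∧
      IsMeagre (g ⁻¹' Eᶜ) ∧ InjOn h E ∧ ∀ M, IsMeagre M → IsMeagre (g ⁻¹' (h ⁻¹' M)) := by
  obtain ⟨𝓑, h𝓑c, h𝓑m, h𝓑⟩ := exists_countable_dense_measurableSet hg
  obtain ⟨B, hB⟩ := (h𝓑c.union (countable_range fun k : ℕ ↦ {x : ℕ → Bool | x k = true})
    ).exists_eq_range ⟨_, Or.inr (mem_range_self 0)⟩
  have hBm (n : ℕ) : MeasurableSet (B n) := by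
    have : B n ∈ _ := hB ▸ mem_range_self n
    rcases this with h | ⟨k, hk⟩
    · exact h𝓑m _ h
    · rw [← hk]
      exact measurableSet_eq_fun (by fun_prop) (by fun_prop)
  choose T hTm hT using fun n ↦ exists_split_deciding hfib (hBm n)
  have hpos (s : List Bool) : ¬ IsMeagre (g ⁻¹' splittingCell T s) := by
    induction s with
    | nil => exact not_isMeagre_of_isOpen isOpen_univ univ_nonempty
    | cons b s ih =>
      obtain ⟨h1, h2, -⟩ := hT s.length _ ih
      cases b
      exacts [h2, h1]
  have hdec (s : List Bool) (n : ℕ) (hs : s.length = n + 1) :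
      IsMeagre (g ⁻¹' (splittingCell T s ∩ B n)) ∨ IsMeagre (g ⁻¹' (splittingCell T s \ B n)) := by
    obtain - | ⟨b, s⟩ := s
    · simp at hs
    obtain rfl : s.length = n := by simpa using hs
    obtain ⟨-, -, h1, h2⟩ := hT s.length _ (hpos s)
    cases b
    exacts [h2, h1]
  have hBdense (D : Set (ℕ → Bool)) (hD : MeasurableSet D) (hDpos : ¬ IsMeagre (g ⁻¹' D)) :
      ∃ s, IsMeagre (g ⁻¹' (splittingCell T s \ D)) := by
    obtain ⟨A, hA, hApos, hAD⟩ := h𝓑 D hD hDpos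
    obtain ⟨n, rfl⟩ : A ∈ range B := hB ▸ Or.inl hA
    by_contra! hcon
    refine hApos ((isMeagre_iUnion (ι' := {s : List Bool // s.length = n + 1})
      (f := fun s ↦ g ⁻¹' (splittingCell T s ∩ B n)) fun s ↦ ?_).mono fun x hx ↦ ?_)
    · refine (hdec s n s.2).resolve_right fun h ↦ hcon s ((h.union hAD).mono fun x hx ↦ ?_)
      by_cases hxB : g x ∈ B n
      exacts [Or.inr ⟨hxB, hx.2⟩, Or.inl ⟨hx.1, hxB⟩]
    · exact mem_iUnion.2 ⟨⟨_, PiNat.res_length _ _⟩, mem_splittingCell_res T (g x) (n + 1), hx⟩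
  have hmeas : Measurable (splittingMap T) := measurable_splittingMap hTm
  have hcell := measurableSet_splittingCell hTm
  let N := ⋃ (n : ℕ) (s : List Bool),
    (⋃ _ : IsMeagre (g ⁻¹' (splittingCell T s ∩ B n)), splittingCell T s ∩ B n) ∪
      ⋃ _ : IsMeagre (g ⁻¹' (splittingCell T s \ B n)), splittingCell T s \ B n
  refine ⟨splittingMap T, Nᶜ, hmeas, ?_, ?_, ?_, ?_⟩
  · refine (MeasurableSet.iUnion fun n ↦ .iUnion fun s ↦ .union ?_ ?_).compl
    · exact .iUnion fun _ ↦ (hcell s).inter (hBm n)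
    · exact .iUnion fun _ ↦ (hcell s).diff (hBm n)
  · simp only [N, compl_compl, preimage_iUnion, preimage_union]
    refine isMeagre_iUnion fun n ↦ isMeagre_iUnion fun s ↦ .union ?_ ?_
    · exact isMeagre_iUnion id
    · exact isMeagre_iUnion id
  · have hN {x : ℕ → Bool} (hx : x ∈ Nᶜ) (n : ℕ) {s : List Bool} (hxs : x ∈ splittingCell T s) :
        (IsMeagre (g ⁻¹' (splittingCell T s ∩ B n)) → x ∉ B n) ∧
        (IsMeagre (g ⁻¹' (splittingCell T s \ B n)) → x ∈ B n) := by
      simp only [N, mem_compl_iff, mem_iUnion, mem_union, not_exists, not_or, mem_inter_iff,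
        Set.mem_sdiff] at hx
      have := hx n s
      tauto
    intro x hx y hy hxy
    funext k
    obtain ⟨n, hn⟩ : {x : ℕ → Bool | x k = true} ∈ range B := hB ▸ Or.inr (mem_range_self k)
    have hxs := mem_splittingCell_res T x (n + 1)
    have hys := mem_splittingCell_res T y (n + 1)
    rw [← hxy] at hys
    have hiff : x ∈ B n ↔ y ∈ B n := by
      have hx' := hN hx n hxs
      have hy' := hN hy n hys
      rcases hdec _ n (PiNat.res_length (splittingMap T x) (n + 1)) with h | h <;> tauto
    rw [hn] at hiff
    exact Bool.eq_iff_iff.2 hiff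
  · intro M hM
    obtain ⟨S, hS, hSc, hMS⟩ := isMeagre_iff_countable_union_isNowhereDense.1 hM
    refine (isMeagre_biUnion hSc (f := fun K ↦ g ⁻¹' (splittingMap T ⁻¹' closure K))
      fun K hK ↦ ?_).mono fun x hx ↦ ?_
    · by_contra hpre
      obtain ⟨s, hs⟩ := hBdense _ (hmeas isClosed_closure.measurableSet) hpre
      obtain ⟨x, hx⟩ := nonempty_of_not_isMeagre (hpos s)
      rw [mem_preimage, mem_splittingCell_iff] at hx
      set z := splittingMap T (g x)
      obtain ⟨y, hyz, hyK⟩ : ∃ y ∈ PiNat.cylinder z s.length, y ∉ closure K := by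
        by_contra! hcon
        have hint := interior_maximal hcon (PiNat.isOpen_cylinder _ z s.length)
        rw [(hS K hK : interior (closure K) = ∅)] at hint
        exact hint (PiNat.self_mem_cylinder z _)
      obtain ⟨m, hm⟩ := PiNat.exists_disjoint_cylinder isClosed_closure hyK
      refine hpos (PiNat.res y (max m s.length)) (hs.mono fun w hw ↦ ?_)
      rw [mem_preimage, mem_splittingCell_iff, PiNat.res_length, PiNat.res_eq_res] at hw
      refine ⟨?_, fun hwK ↦ hm.notMem_of_mem_left hwK fun i hi ↦ hw (lt_max_of_lt_left hi)⟩
      rw [mem_splittingCell_iff]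
      refine Eq.trans ?_ hx
      rw [PiNat.res_eq_res]
      exact fun i hi ↦ (hw (lt_max_of_lt_right hi)).trans (hyz i hi)
    · obtain ⟨K, hK, hxK⟩ := hMS hx
      exact mem_biUnion hK (subset_closure hxK)

theorem continuous_natCases_bool (b : Bool) :
    Continuous fun x : ℕ → Bool ↦ (fun n ↦ Nat.casesOn n b x : ℕ → Bool) := by
  refine continuous_pi fun n ↦ ?_
  cases n with
  | zero => exact continuous_const
  | succ n => exact continuous_apply n

theorem isOpenMap_natCases_bool (b : Bool) :
    IsOpenMap fun x : ℕ → Bool ↦ (fun n ↦ Nat.casesOn n b x : ℕ → Bool) := by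
  intro U hU
  have : (fun x : ℕ → Bool ↦ (fun n ↦ Nat.casesOn n b x : ℕ → Bool)) '' U =
      (fun y : ℕ → Bool ↦ y 0) ⁻¹' {b} ∩ (fun (y : ℕ → Bool) n ↦ y (n + 1)) ⁻¹' U := by
    ext y
    constructor
    · rintro ⟨x, hx, rfl⟩
      exact ⟨rfl, hx⟩
    · rintro ⟨rfl, hy⟩
      refine ⟨_, hy, funext fun n ↦ ?_⟩
      cases n <;> rfl
  rw [this]
  exact ((isOpen_discrete {b}).preimage (continuous_apply 0)).inter (hU.preimage (by fun_prop))

/-- A set with nonmeager preimage under a Borel map with meager fibers is not universally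
meager. -/
theorem not_universallyMeager_of_not_isMeagre_preimage {R : Type*} [TopologicalSpace R]
    [SecondCountableTopology R] [BaireSpace R] [MeasurableSpace R] [BorelSpace R]
    {g : R → ℕ → Bool} (hg : Measurable g) (hfib : ∀ y, IsMeagre (g ⁻¹' {y}))
    {X : Set (ℕ → Bool)} (hX : ¬ IsMeagre (g ⁻¹' X)) : ¬ UniversallyMeager X := by
  classical
  intro hum
  have : Nonempty R := (nonempty_of_not_isMeagre hX).to_type
  obtain ⟨h, E, hh, hE, hEc, hinj, hM⟩ := exists_measurable_injOn_isMeagre_preimage hg hfib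
  let c (b : Bool) (x : ℕ → Bool) : ℕ → Bool := fun n ↦ Nat.casesOn n b x
  have hc (b : Bool) : Function.Injective (c b) := fun x y hxy ↦
    funext fun n ↦ congrFun hxy (n + 1)
  let f : (ℕ → Bool) → ℕ → Bool := E.piecewise (c true ∘ h) (c false)
  have hf : Measurable f := Measurable.piecewise hE
    ((continuous_natCases_bool true).measurable.comp hh) (continuous_natCases_bool false).measurable
  have hfinj : Function.Injective f := by
    refine (injective_piecewise_iff _).2 ⟨(hc true).comp_injOn hinj, (hc false).injOn, ?_⟩
    intro x _ y _ hxy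
    exact Bool.noConfusion (congrFun hxy 0)
  have hpre := hM _ ((hum f hfinj hf).preimage_of_isOpenMap (continuous_natCases_bool true)
    (isOpenMap_natCases_bool true))
  refine hX ((hpre.union hEc).mono fun x hx ↦ ?_)
  by_cases hxE : g x ∈ E
  · exact Or.inl ⟨g x, hx, piecewise_eq_of_mem _ _ _ hxE⟩
  · exact Or.inr hxE

/-- Fibers of a continuous nowhere constant map are meager. -/
theorem isMeagre_preimage_singleton_of_nowhere_constant {R Y : Type*} [TopologicalSpace R]
    [TopologicalSpace Y] [T1Space Y] {g : R → Y} (hg : Continuous g)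
    (hne : ∀ U : Set R, IsOpen U → U.Nonempty → ∃ x ∈ U, ∃ y ∈ U, g x ≠ g y) (y : Y) :
    IsMeagre (g ⁻¹' {y}) := by
  refine IsNowhereDense.isMeagre ((isClosed_singleton.preimage hg).isNowhereDense_iff.2 ?_)
  by_contra! h
  obtain ⟨a, ha, b, hb, hab⟩ := hne _ isOpen_interior h
  have ha' : g a = y := interior_subset (s := g ⁻¹' {y}) ha
  have hb' : g b = y := interior_subset (s := g ⁻¹' {y}) hb
  exact hab (ha'.trans hb'.symm)

end


/-- Let `L ⊆ 2^ω` be a Luzin set (uncountable, with countable intersection with every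
meager set) with no isolated points in its subspace topology, let `f : L → 2^ω` be an
injective continuous map, and let `X ⊆ 2^ω` be such that `f[L] ∩ X` is uncountable.
Then there exist a nonempty Polish space `R` and a continuous nowhere constant map
`g : R → 2^ω` such that `g ⁻¹' X` is not meager in `R`; consequently `X` is not
universally meager. -/
theorem not_universallyMeager_of_luzin_image
    (L : Set (ℕ → Bool))
    (hL_unc : ¬ L.Countable)
    (hL_luzin : ∀ M : Set (ℕ → Bool), IsMeagre M → (L ∩ M).Countable)
    (hL_perf : Preperfect L)
    (f : L → (ℕ → Bool)) (hf_cont : Continuous f) (hf_inj : Function.Injective f)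
    (X : Set (ℕ → Bool)) (hX : ¬ (Set.range f ∩ X).Countable) :
    (∃ (R : Type) (tR : TopologicalSpace R) (g : R → (ℕ → Bool)),
        @PolishSpace R tR ∧ Nonempty R ∧ @Continuous R (ℕ → Bool) tR _ g ∧
        (∀ U : Set R, @IsOpen R tR U → U.Nonempty → ∃ x ∈ U, ∃ y ∈ U, g x ≠ g y) ∧
        ¬ @IsMeagre R tR (g ⁻¹' X)) ∧
      ¬ UniversallyMeager X := by
  classical
  let A : Set (ℕ → Bool) := Subtype.val '' (f ⁻¹' X)
  have hA {x : ℕ → Bool} (hx : x ∈ A) : ∃ a : L, f a ∈ X ∧ (a : ℕ → Bool) = x := hx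
  have hA_unc : ¬ A.Countable := fun h ↦ hX <| by
    rw [Set.inter_comm, ← Set.image_preimage_eq_inter_range]
    exact (Set.countable_of_injective_of_countable_image Subtype.val_injective.injOn h).image f
  let P (n : ℕ) (b : Bool) : Set (ℕ → Bool) :=
    interior {x | ∀ h : x ∈ L, f ⟨x, h⟩ n = b}
  have hP_open (n : ℕ) (b : Bool) : IsOpen (P n b) := isOpen_interior
  have hP_val {n : ℕ} {b : Bool} {a : L} (ha : (a : ℕ → Bool) ∈ P n b) : f a n = b :=
    interior_subset ha a.2
  have hP_mem (a : L) (n : ℕ) : (a : ℕ → Bool) ∈ P n (f a n) := by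
    have hopen : IsOpen ((fun x ↦ f x n) ⁻¹' {f a n}) :=
      (isOpen_discrete _).preimage ((continuous_apply n).comp hf_cont)
    obtain ⟨V, hV, hVf⟩ := isOpen_induced_iff.1 hopen
    refine mem_interior.2 ⟨V, fun x hx hxL ↦ ?_, hV, ?_⟩
    · have : (⟨x, hxL⟩ : L) ∈ Subtype.val ⁻¹' V := hx
      rw [hVf] at this
      exact this
    · have : a ∈ (fun x ↦ f x n) ⁻¹' {f a n} := rfl
      rwa [← hVf] at this
  let U : Set (ℕ → Bool) := interior (closure A)
  have hUA {V : Set (ℕ → Bool)} (hV : IsOpen V) (hVU : (V ∩ U).Nonempty) :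
      ∃ a : L, f a ∈ X ∧ (a : ℕ → Bool) ∈ V ∩ U := by
    obtain ⟨x, hx⟩ := hVU
    obtain ⟨y, hy, hyA⟩ :=
      mem_closure_iff.1 (interior_subset hx.2) _ (hV.inter isOpen_interior) hx
    obtain ⟨a, haX, rfl⟩ := hA hyA
    exact ⟨a, haX, hy⟩
  let S : Set (ℕ → Bool) := U ∩ ⋂ n, (P n true ∪ P n false)
  have hS : IsGδ S := isOpen_interior.isGδ.inter
    (.iInter fun n ↦ ((hP_open n true).union (hP_open n false)).isGδ)
  have hLS {a : L} (ha : (a : ℕ → Bool) ∈ U) : (a : ℕ → Bool) ∈ S := by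
    refine ⟨ha, Set.mem_iInter.2 fun n ↦ ?_⟩
    have := hP_mem a n
    cases h : f a n <;> rw [h] at this
    exacts [Or.inr this, Or.inl this]
  let g (x : S) (n : ℕ) : Bool := decide ((x : ℕ → Bool) ∈ P n true)
  have hg_eq {a : L} (ha : (a : ℕ → Bool) ∈ S) : g ⟨a, ha⟩ = f a := by
    funext n
    have := hP_mem a n
    by_cases h : (a : ℕ → Bool) ∈ P n true
    · simp [g, h, hP_val h]
    · cases hfa : f a n
      · simp [g, h]
      · exact (h (hfa ▸ this)).elim
  have hdisj (n : ℕ) {x : ℕ → Bool} (hxU : x ∈ U) (ht : x ∈ P n true) (hf : x ∈ P n false) :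
      False := by
    obtain ⟨a, -, ha, -⟩ := hUA ((hP_open n true).inter (hP_open n false)) ⟨x, ⟨ht, hf⟩, hxU⟩
    exact Bool.noConfusion ((hP_val ha.1).symm.trans (hP_val ha.2))
  have hg_cont : Continuous g := by
    refine continuous_pi fun n ↦ (continuous_bool_rng true).2 ?_
    have hpre : (fun x ↦ g x n) ⁻¹' {true} = Subtype.val ⁻¹' P n true := by
      ext x
      simp [g]
    have hpre_compl : (Subtype.val ⁻¹' P n true : Set S)ᶜ = Subtype.val ⁻¹' P n false := by
      ext x
      have hor : (x : ℕ → Bool) ∈ P n true ∨ (x : ℕ → Bool) ∈ P n false :=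
        Set.mem_iInter.1 x.2.2 n
      exact ⟨hor.resolve_left, fun hx ht ↦ hdisj n x.2.1 ht hx⟩
    rw [hpre]
    refine ⟨⟨?_⟩, (hP_open n true).preimage continuous_subtype_val⟩
    rw [hpre_compl]
    exact (hP_open n false).preimage continuous_subtype_val
  have hg_nonconst (W : Set S) (hW : IsOpen W) (hWne : W.Nonempty) :
      ∃ x ∈ W, ∃ y ∈ W, g x ≠ g y := by
    obtain ⟨V, hV, rfl⟩ := isOpen_induced_iff.1 hW
    obtain ⟨x, hx⟩ := hWne
    obtain ⟨a, -, haV, haU⟩ := hUA hV ⟨x, hx, x.2.1⟩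
    obtain ⟨y, ⟨hyV, hyL⟩, hya⟩ := accPt_iff_nhds.1 (hL_perf a a.2) (V ∩ U)
      ((hV.inter isOpen_interior).mem_nhds ⟨haV, haU⟩)
    refine ⟨⟨a, hLS haU⟩, haV, ⟨y, hLS (a := ⟨y, hyL⟩) hyV.2⟩, hyV.1, ?_⟩
    rw [hg_eq, hg_eq (a := ⟨y, hyL⟩)]
    exact fun h ↦ hya (congrArg Subtype.val (hf_inj h)).symm
  have hAU : ¬ (A ∩ U).Countable := by
    intro h
    have hnd : IsNowhereDense (closure A \ U) := by
      refine (isClosed_closure.sdiff isOpen_interior).isNowhereDense_iff.2 ?_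
      rw [Set.eq_empty_iff_forall_notMem]
      exact fun x hx ↦ (interior_subset hx).2 (interior_mono Set.sdiff_subset hx)
    refine hA_unc ((h.union (hL_luzin _ hnd.isMeagre)).mono fun x hx ↦ ?_)
    by_cases hxU : x ∈ U
    · exact Or.inl ⟨hx, hxU⟩
    · obtain ⟨a, -, rfl⟩ := hA hx
      exact Or.inr ⟨a.2, subset_closure hx, hxU⟩
  have hg_pre : ¬ IsMeagre (g ⁻¹' X) := by
    intro h
    refine hAU ((hL_luzin _ h.image_val).mono fun x hx ↦ ?_)
    obtain ⟨a, haX, rfl⟩ := hA hx.1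
    refine ⟨a.2, ⟨a, hLS hx.2⟩, ?_, rfl⟩
    rw [Set.mem_preimage, hg_eq]
    exact haX
  have : PolishSpace (ℕ → Bool) := by
    have : TopologicalSpace.IsCompletelyMetrizableSpace (ℕ → Bool) :=
      ⟨PiNat.metricSpace, rfl, PiNat.completeSpace⟩
    infer_instance
  have hS_polish : PolishSpace S := hS.polishSpace
  refine ⟨⟨S, inferInstance, g, hS_polish, (nonempty_of_not_isMeagre hg_pre).to_type, hg_cont,
    hg_nonconst, hg_pre⟩, ?_⟩
  borelize ↥S
  exact not_universallyMeager_of_not_isMeagre_preimage hg_cont.measurable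
    (isMeagre_preimage_singleton_of_nowhere_constant hg_cont hg_nonconst) hg_pre
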